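/- arXiv:2509.08258 — 2 statements merged into one kernel-verified Lean document; each statement's English description precedes it below -/
import Mathlib

section
/- Under Assumption 2 (F μ_F-strongly convex, G μ_G-strongly convex, ∇F and ∇G locally Lipschitz), let (x(t), y(t)) be the global C² solution on [t_0, +∞) of the dynamical system ẍ + 2√μ_F ẋ + ∇F(x) + Aᵀ(y + γẏ) = 0, ÿ + 2√μ_G ẏ + ∇G(y) − A(x + γẋ) = 0 with γ = max{1/√μ_F, 1/√μ_G}, and let (x*, y*) be the unique saddle point of L. Then there exists a constant C > 0 such that for all t ≥ t_0: ‖ẋ(t)‖² + ‖ẏ(t)‖² ≤ C e^{−t/γ}, i.e. ‖ẋ(t)‖² + ‖ẏ(t)‖² = O(e^{−min{√μ_F, √μ_G} t}). -/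
open scoped RealInnerProductSpace

section Dissipation

variable {V : Type*} [NormedAddCommGroup V] [InnerProductSpace ℝ V]

/-- Dissipation estimate for one block of the primal-dual system: `w` is the displacement from the
equilibrium, `p` the velocity, `q` the acceleration, `g` the gradient at the current point and `k`
the coupling force. -/
lemma block_dissipation {γ μ r φ : ℝ} (hγ : 0 < γ) (hr : r ^ 2 = μ) (hγr : 1 ≤ γ * r)
    {w p q g k : V} (hq : q = -((2 * r) • p) - g - k)
    (hφ : φ + μ / 2 * ‖w‖ ^ 2 ≤ ⟪g, w⟫) :
    γ ^ 2 * ⟪g, p⟫ + ⟪w + γ • p, p + γ • q⟫ + 1 / γ * (γ ^ 2 * φ + 1 / 2 * ‖w + γ • p‖ ^ 2)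
      ≤ -γ * ⟪w + γ • p, k⟫ := by
  have hsq : ‖w + γ • p‖ ^ 2 = ‖w‖ ^ 2 + 2 * γ * ⟪w, p⟫ + γ ^ 2 * ‖p‖ ^ 2 := by
    rw [norm_add_sq_real, inner_smul_right, norm_smul, mul_pow, Real.norm_eq_abs, sq_abs]
    ring
  have hinner : ⟪w + γ • p, p + γ • q⟫ = (1 - 2 * (γ * r)) * (⟪w, p⟫ + γ * ‖p‖ ^ 2)
      - γ * (⟪g, w⟫ + γ * ⟪g, p⟫) - γ * ⟪w + γ • p, k⟫ := by
    subst hq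
    simp only [inner_add_left, inner_add_right, inner_sub_right, inner_neg_right,
      inner_smul_left, inner_smul_right, real_inner_self_eq_norm_sq, real_inner_comm g,
      RCLike.conj_to_real]
    ring
  have hw : 0 ≤ (γ * r - 1) / γ * ‖w + γ • p‖ ^ 2 :=
    mul_nonneg (div_nonneg (by linarith) hγ.le) (sq_nonneg _)
  have hw' : 0 ≤ (γ * r - 1) ^ 2 / (2 * γ) * ‖w‖ ^ 2 := by positivity
  have hp : 0 ≤ γ * (γ * r - 1 / 2) * ‖p‖ ^ 2 :=
    mul_nonneg (mul_nonneg hγ.le (by linarith)) (sq_nonneg _)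
  have hφ' := mul_le_mul_of_nonneg_left hφ hγ.le
  have hsum : (γ * r - 1) / γ * ‖w + γ • p‖ ^ 2 + (γ * r - 1) ^ 2 / (2 * γ) * ‖w‖ ^ 2
        + γ * (γ * r - 1 / 2) * ‖p‖ ^ 2
      = (2 * (γ * r) - 1) * (⟪w, p⟫ + γ * ‖p‖ ^ 2) + γ * (μ / 2 * ‖w‖ ^ 2)
        - 1 / γ * (1 / 2 * ‖w + γ • p‖ ^ 2) := by
    rw [hsq, ← hr]
    field_simp
    ring
  have hφγ : 1 / γ * (γ ^ 2 * φ) = γ * φ := by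
    field_simp
  rw [hinner, mul_add (1 / γ), hφγ]
  linarith

lemma sq_norm_velocity_le {γ μ φ : ℝ} (hγμ : 1 ≤ γ ^ 2 * μ) {w p : V}
    (hφ : μ / 2 * ‖w‖ ^ 2 ≤ φ) :
    γ ^ 2 * ‖p‖ ^ 2 ≤ 4 * (γ ^ 2 * φ + 1 / 2 * ‖w + γ • p‖ ^ 2) := by
  have h1 : ‖w + γ • p‖ ^ 2 = ‖w‖ ^ 2 + 2 * ⟪w, γ • p⟫ + γ ^ 2 * ‖p‖ ^ 2 := by
    rw [norm_add_sq_real, norm_smul, mul_pow, Real.norm_eq_abs, sq_abs]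
  have h2 : ‖(2 : ℝ) • w + γ • p‖ ^ 2 = 4 * ‖w‖ ^ 2 + 4 * ⟪w, γ • p⟫ + γ ^ 2 * ‖p‖ ^ 2 := by
    rw [norm_add_sq_real, norm_smul, norm_smul, mul_pow, mul_pow, inner_smul_left]
    simp only [Real.norm_eq_abs, sq_abs, RCLike.conj_to_real]
    ring
  have h3 := mul_le_mul_of_nonneg_left hφ (sq_nonneg γ)
  have h4 := mul_le_mul_of_nonneg_right hγμ (sq_nonneg ‖w‖)
  nlinarith [sq_nonneg ‖(2 : ℝ) • w + γ • p‖]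

end Dissipation

lemma le_exp_mul_of_hasDerivAt_add_mul_nonpos {E E' : ℝ → ℝ} {c t0 : ℝ}
    (hE : ∀ t, t0 ≤ t → HasDerivAt E (E' t) t) (hE' : ∀ t, t0 ≤ t → E' t + c * E t ≤ 0)
    {t : ℝ} (ht : t0 ≤ t) : E t ≤ E t0 * Real.exp (c * t0) * Real.exp (-(c * t)) := by
  have hd : ∀ s, t0 ≤ s → HasDerivAt (fun s => E s * Real.exp (c * s))
      (E' s * Real.exp (c * s) + E s * (Real.exp (c * s) * c)) s := fun s hs => by
    simpa using (hE s hs).fun_mul ((hasDerivAt_id s).const_mul c).exp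
  have hanti : AntitoneOn (fun s => E s * Real.exp (c * s)) (Set.Ici t0) := by
    refine antitoneOn_of_deriv_nonpos (convex_Ici t0)
      (fun s hs => (hd s hs).continuousAt.continuousWithinAt) ?_ ?_ <;>
      intro s hs <;> have hs' : t0 ≤ s := interior_subset hs
    · exact (hd s hs').differentiableAt.differentiableWithinAt
    · rw [(hd s hs').deriv]
      nlinarith [hE' s hs', Real.exp_pos (c * s)]
  have h : E t * Real.exp (c * t) ≤ E t0 * Real.exp (c * t0) := hanti Set.self_mem_Ici ht ht
  rw [Real.exp_neg, ← div_eq_mul_inv, le_div_iff₀ (Real.exp_pos _)]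
  exact h

theorem stmt_18 {n m : ℕ} (F : EuclideanSpace ℝ (Fin n) → ℝ)
    (G : EuclideanSpace ℝ (Fin m) → ℝ)
    (F' : EuclideanSpace ℝ (Fin n) → EuclideanSpace ℝ (Fin n))
    (G' : EuclideanSpace ℝ (Fin m) → EuclideanSpace ℝ (Fin m))
    (μF μG : ℝ) (hμF : 0 < μF) (hμG : 0 < μG)
    (A : EuclideanSpace ℝ (Fin n) →L[ℝ] EuclideanSpace ℝ (Fin m))
    (hFdiff : ∀ z, HasGradientAt F (F' z) z)
    (hGdiff : ∀ z, HasGradientAt G (G' z) z)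
    (hFsc : ∀ a b, F b ≥ F a + ⟪F' a, b - a⟫ + μF / 2 * ‖b - a‖ ^ 2)
    (hGsc : ∀ a b, G b ≥ G a + ⟪G' a, b - a⟫ + μG / 2 * ‖b - a‖ ^ 2)
    (hFlip : LocallyLipschitz F') (hGlip : LocallyLipschitz G')
    (γ : ℝ) (hγ : γ = max (1 / Real.sqrt μF) (1 / Real.sqrt μG))
    (L : EuclideanSpace ℝ (Fin n) → EuclideanSpace ℝ (Fin m) → ℝ)
    (hL : ∀ p q, L p q = F p + ⟪A p, q⟫ - G q)
    (xstar : EuclideanSpace ℝ (Fin n)) (ystar : EuclideanSpace ℝ (Fin m))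
    (hsaddle : ∀ p q, L xstar q ≤ L xstar ystar ∧ L xstar ystar ≤ L p ystar)
    (hfoc1 : F' xstar + (ContinuousLinearMap.adjoint A) ystar = 0)
    (hfoc2 : G' ystar - A xstar = 0)
    (t0 : ℝ) (ht0 : 0 ≤ t0)
    (x x' x'' : ℝ → EuclideanSpace ℝ (Fin n))
    (y y' y'' : ℝ → EuclideanSpace ℝ (Fin m))
    (hx : ∀ t ∈ Set.Ici t0, HasDerivAt x (x' t) t)
    (hx' : ∀ t ∈ Set.Ici t0, HasDerivAt x' (x'' t) t)
    (hy : ∀ t ∈ Set.Ici t0, HasDerivAt y (y' t) t)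
    (hy' : ∀ t ∈ Set.Ici t0, HasDerivAt y' (y'' t) t)
    (hx''c : ContinuousOn x'' (Set.Ici t0)) (hy''c : ContinuousOn y'' (Set.Ici t0))
    (hode1 : ∀ t ∈ Set.Ici t0,
      x'' t + (2 * Real.sqrt μF) • x' t + F' (x t)
        + (ContinuousLinearMap.adjoint A) (y t + γ • y' t) = 0)
    (hode2 : ∀ t ∈ Set.Ici t0,
      y'' t + (2 * Real.sqrt μG) • y' t + G' (y t) - A (x t + γ • x' t) = 0)
    (u : ℝ → EuclideanSpace ℝ (Fin n)) (v : ℝ → EuclideanSpace ℝ (Fin m))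
    (hu : ∀ t, u t = x t - xstar + γ • x' t)
    (hv : ∀ t, v t = y t - ystar + γ • y' t)
    (E : ℝ → ℝ)
    (hE : ∀ t, E t = γ ^ 2 * (L (x t) ystar - L xstar (y t))
      + 1 / 2 * ‖u t‖ ^ 2 + 1 / 2 * ‖v t‖ ^ 2)
    : ∃ C : ℝ, 0 < C ∧ ∀ t, t0 ≤ t →
      ‖x' t‖ ^ 2 + ‖y' t‖ ^ 2 ≤ C * Real.exp (-t / γ) := by
  have hrF : 0 < √μF := Real.sqrt_pos.2 hμF
  have hrG : 0 < √μG := Real.sqrt_pos.2 hμG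
  have hγF : 1 ≤ γ * √μF := (div_le_iff₀ hrF).1 (hγ ▸ le_max_left _ _)
  have hγG : 1 ≤ γ * √μG := (div_le_iff₀ hrG).1 (hγ ▸ le_max_right _ _)
  have hγ0 : 0 < γ := pos_of_mul_pos_left (one_pos.trans_le hγF) hrF.le
  have hsF : √μF ^ 2 = μF := Real.sq_sqrt hμF.le
  have hsG : √μG ^ 2 = μG := Real.sq_sqrt hμG.le
  set B := ContinuousLinearMap.adjoint A with hB
  have hBA : ∀ p q, ⟪B q, p⟫ = ⟪A p, q⟫ := fun p q => by
    rw [hB, ContinuousLinearMap.adjoint_inner_left, real_inner_comm]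
  let φ := fun p => F p - F xstar + ⟪B ystar, p - xstar⟫
  let ψ := fun q => G q - G ystar - ⟪A xstar, q - ystar⟫
  have hEφψ : ∀ t, E t = (γ ^ 2 * φ (x t) + 1 / 2 * ‖x t - xstar + γ • x' t‖ ^ 2)
      + (γ ^ 2 * ψ (y t) + 1 / 2 * ‖y t - ystar + γ • y' t‖ ^ 2) := fun t => by
    simp only [hE, hL, hu, hv, φ, ψ, hBA, map_sub, inner_sub_left, inner_sub_right]
    ring
  have hφ_ge : ∀ p, μF / 2 * ‖p - xstar‖ ^ 2 ≤ φ p := fun p => by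
    have h := hFsc xstar p
    rw [eq_neg_of_add_eq_zero_left hfoc1, inner_neg_left] at h
    simp only [φ]
    linarith
  have hψ_ge : ∀ q, μG / 2 * ‖q - ystar‖ ^ 2 ≤ ψ q := fun q => by
    have h := hGsc ystar q
    rw [sub_eq_zero.1 hfoc2] at h
    simp only [ψ]
    linarith
  have hφ_grad : ∀ p, φ p + μF / 2 * ‖p - xstar‖ ^ 2 ≤ ⟪F' p + B ystar, p - xstar⟫ := fun p => by
    have h := hFsc p xstar
    rw [← neg_sub p xstar, inner_neg_right, norm_neg] at h
    simp only [φ, inner_add_left]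
    linarith
  have hψ_grad : ∀ q, ψ q + μG / 2 * ‖q - ystar‖ ^ 2 ≤ ⟪G' q - A xstar, q - ystar⟫ := fun q => by
    have h := hGsc q ystar
    rw [← neg_sub q ystar, inner_neg_right, norm_neg] at h
    simp only [ψ, inner_sub_left]
    linarith
  have hφ_deriv : ∀ t, t0 ≤ t →
      HasDerivAt (fun t => φ (x t)) ⟪F' (x t) + B ystar, x' t⟫ t := fun t ht => by
    have h1 := (hFdiff (x t)).hasFDerivAt.comp_hasDerivAt t (hx t ht)
    have h2 := (innerSL ℝ (B ystar)).hasFDerivAt.comp_hasDerivAt t ((hx t ht).sub_const xstar)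
    simpa [inner_add_left, Function.comp_def, φ] using (h1.sub_const (F xstar)).fun_add h2
  have hψ_deriv : ∀ t, t0 ≤ t →
      HasDerivAt (fun t => ψ (y t)) ⟪G' (y t) - A xstar, y' t⟫ t := fun t ht => by
    have h1 := (hGdiff (y t)).hasFDerivAt.comp_hasDerivAt t (hy t ht)
    have h2 := (innerSL ℝ (A xstar)).hasFDerivAt.comp_hasDerivAt t ((hy t ht).sub_const ystar)
    simpa [inner_sub_left, Function.comp_def, ψ] using (h1.sub_const (G ystar)).fun_sub h2
  have hE_deriv : ∀ t, t0 ≤ t → HasDerivAt E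
      ((γ ^ 2 * ⟪F' (x t) + B ystar, x' t⟫
          + ⟪x t - xstar + γ • x' t, x' t + γ • x'' t⟫)
        + (γ ^ 2 * ⟪G' (y t) - A xstar, y' t⟫
          + ⟪y t - ystar + γ • y' t, y' t + γ • y'' t⟫)) t := fun t ht => by
    have h1 := (((hx t ht).sub_const xstar).add ((hx' t ht).const_smul γ)).norm_sq
    have h2 := (((hy t ht).sub_const ystar).add ((hy' t ht).const_smul γ)).norm_sq
    rw [funext hEφψ]
    refine ((((hφ_deriv t ht).const_mul (γ ^ 2)).add (h1.const_mul (1 / 2))).add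
      (((hψ_deriv t ht).const_mul (γ ^ 2)).add (h2.const_mul (1 / 2)))).congr_deriv ?_
    simp only [Pi.add_apply, Pi.smul_apply]
    ring
  have hE_le : ∀ t, t0 ≤ t → E t ≤ E t0 * Real.exp (1 / γ * t0) * Real.exp (-(1 / γ * t)) := by
    refine fun t ht => le_exp_mul_of_hasDerivAt_add_mul_nonpos hE_deriv (fun s hs => ?_) ht
    have h1 := block_dissipation (w := x s - xstar) (p := x' s) (q := x'' s)
      (k := B (y s - ystar + γ • y' s)) hγ0 hsF hγF (by
        rw [← sub_eq_zero, ← hode1 s hs]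
        simp only [map_add, map_sub]
        abel) (hφ_grad (x s))
    have h2 := block_dissipation (w := y s - ystar) (p := y' s) (q := y'' s)
      (k := -A (x s - xstar + γ • x' s)) hγ0 hsG hγG (by
        rw [← sub_eq_zero, ← hode2 s hs]
        simp only [map_add, map_sub]
        abel) (hψ_grad (y s))
    rw [ContinuousLinearMap.adjoint_inner_right, real_inner_comm _ (A _)] at h1
    rw [inner_neg_right] at h2
    rw [hEφψ]
    linarith
  have hv_le : ∀ t, γ ^ 2 * (‖x' t‖ ^ 2 + ‖y' t‖ ^ 2) ≤ 4 * E t := fun t => by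
    have h1 := sq_norm_velocity_le (γ := γ) (p := x' t)
      (by rw [← hsF, ← mul_pow]; exact one_le_pow₀ hγF) (hφ_ge (x t))
    have h2 := sq_norm_velocity_le (γ := γ) (p := y' t)
      (by rw [← hsG, ← mul_pow]; exact one_le_pow₀ hγG) (hψ_ge (y t))
    rw [hEφψ]
    linarith
  have hE0 : 0 ≤ E t0 := by
    have := hv_le t0
    have : 0 ≤ γ ^ 2 * (‖x' t0‖ ^ 2 + ‖y' t0‖ ^ 2) := by positivity
    linarith
  refine ⟨4 / γ ^ 2 * (E t0 * Real.exp (1 / γ * t0)) + 1, by positivity, fun t ht => ?_⟩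
  calc ‖x' t‖ ^ 2 + ‖y' t‖ ^ 2 ≤ 4 / γ ^ 2 * E t := by
        rw [div_mul_eq_mul_div, le_div_iff₀ (by positivity), mul_comm]
        exact hv_le t
    _ ≤ 4 / γ ^ 2 * (E t0 * Real.exp (1 / γ * t0) * Real.exp (-(1 / γ * t))) := by
        gcongr
        exact hE_le t ht
    _ = 4 / γ ^ 2 * (E t0 * Real.exp (1 / γ * t0)) * Real.exp (-t / γ) := by
        rw [← mul_assoc, show -(1 / γ * t) = -t / γ by ring]
    _ ≤ _ := by
        gcongr
        linarith
end

section
/- Under Assumption 2 (F μ_F-strongly convex, G μ_G-strongly convex, ∇F and ∇G locally Lipschitz), let (x(t), y(t)) be the global C² solution on [t_0, +∞) of the dynamical system ẍ + 2√μ_F ẋ + ∇F(x) + Aᵀ(y + γẏ) = 0, ÿ + 2√μ_G ẏ + ∇G(y) − A(x + γẋ) = 0 with γ = max{1/√μ_F, 1/√μ_G}, and let (x*, y*) be the unique saddle point of L. Then ∫_{t_0}^{+∞} e^{t/γ}(‖ẋ(t)‖² + ‖ẏ(t)‖²) dt ≤ (2/γ) e^{t_0/γ} E(t_0) < +∞,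 where 1/γ = min{√μ_F, √μ_G} and E is the associated energy. -/
open scoped RealInnerProductSpace

/-- If `H` is nonnegative and `H' ≤ -c h` on `[t₀, ∞)` with `h` nonnegative and continuous, then `h`
is integrable on `(t₀, ∞)` with integral at most `H t₀ / c`. -/
theorem integrableOn_Ioi_and_integral_le_of_hasDerivAt_le {H H' h : ℝ → ℝ} {c t0 : ℝ} (hc : 0 < c)
    (hH : ∀ t ∈ Set.Ici t0, HasDerivAt H (H' t) t) (hHnonneg : ∀ t ∈ Set.Ici t0, 0 ≤ H t)
    (hh : ContinuousOn h (Set.Ici t0)) (hhnonneg : ∀ t, 0 ≤ h t)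
    (hle : ∀ t ∈ Set.Ici t0, H' t ≤ -(c * h t)) :
    MeasureTheory.IntegrableOn h (Set.Ioi t0) ∧ ∫ t in Set.Ioi t0, h t ≤ H t0 / c := by
  have hint : ∀ b, MeasureTheory.IntegrableOn h (Set.Icc t0 b) := fun b =>
    (hh.mono Set.Icc_subset_Ici_self).integrableOn_Icc
  have hbound : ∀ b, t0 ≤ b → ∫ t in t0..b, h t ≤ H t0 / c := by
    intro b hb
    have key := intervalIntegral.integral_le_sub_of_hasDeriv_right_of_le (g := fun t => -(H t / c))
      (g' := fun t => -(H' t / c)) (φ := h) hb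
      (fun t ht => ((hH t ht.1).div_const c).neg.continuousAt.continuousWithinAt)
      (fun t ht => ((hH t ht.1.le).div_const c).neg.hasDerivWithinAt) (hint b)
      (fun t ht => by
        have := hle t ht.1.le
        rw [← neg_div, le_div_iff₀ hc]
        linarith)
    have hHb : 0 ≤ H b / c := div_nonneg (hHnonneg b hb) hc.le
    linarith
  have hI : MeasureTheory.IntegrableOn h (Set.Ioi t0) := by
    refine MeasureTheory.integrableOn_Ioi_of_intervalIntegral_norm_bounded (H t0 / c) t0
      (l := Filter.atTop) (b := id) (fun b => (hint b).mono_set Set.Ioc_subset_Icc_self)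
      Filter.tendsto_id ?_
    filter_upwards [Filter.eventually_ge_atTop t0] with b hb
    simpa only [Real.norm_of_nonneg (hhnonneg _), id] using hbound b hb
  refine ⟨hI, le_of_tendsto
    (MeasureTheory.intervalIntegral_tendsto_integral_Ioi t0 hI Filter.tendsto_id) ?_⟩
  filter_upwards [Filter.eventually_ge_atTop t0] with b hb using hbound b hb

theorem damped_quadratic_form_le {V : Type*} [NormedAddCommGroup V] [InnerProductSpace ℝ V]
    {a γ : ℝ} (hγ : 0 < γ) (ha : 1 ≤ γ * a) (d w : V) :
    (1 - 2 * γ * a) * ⟪d, w⟫ + γ * (1 - 2 * γ * a) * ‖w‖ ^ 2 - γ * (a ^ 2 / 2 * ‖d‖ ^ 2)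
      + 1 / γ * (1 / 2 * ‖d + γ • w‖ ^ 2) ≤ -(γ / 2 * ‖w‖ ^ 2) := by
  have hexp : ‖d + γ • w‖ ^ 2 = ‖d‖ ^ 2 + 2 * γ * ⟪d, w⟫ + γ ^ 2 * ‖w‖ ^ 2 := by
    rw [norm_add_sq_real, inner_smul_right, norm_smul, Real.norm_of_nonneg hγ.le]
    ring
  have hpos : 0 ≤ 1 / γ * ((γ * a - 1) *
      (‖d + γ • w‖ ^ 2 + γ ^ 2 * ‖w‖ ^ 2 + (γ * a - 1) / 2 * ‖d‖ ^ 2)) := by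
    have := sub_nonneg.2 ha
    positivity
  rw [hexp] at hpos ⊢
  refine sub_nonneg.1 (hpos.trans_eq ?_)
  field_simp
  ring

theorem stmt_19 {n m : ℕ} (F : EuclideanSpace ℝ (Fin n) → ℝ)
    (G : EuclideanSpace ℝ (Fin m) → ℝ)
    (F' : EuclideanSpace ℝ (Fin n) → EuclideanSpace ℝ (Fin n))
    (G' : EuclideanSpace ℝ (Fin m) → EuclideanSpace ℝ (Fin m))
    (μF μG : ℝ) (hμF : 0 < μF) (hμG : 0 < μG)
    (A : EuclideanSpace ℝ (Fin n) →L[ℝ] EuclideanSpace ℝ (Fin m))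
    (hFdiff : ∀ z, HasGradientAt F (F' z) z)
    (hGdiff : ∀ z, HasGradientAt G (G' z) z)
    (hFsc : ∀ a b, F b ≥ F a + ⟪F' a, b - a⟫ + μF / 2 * ‖b - a‖ ^ 2)
    (hGsc : ∀ a b, G b ≥ G a + ⟪G' a, b - a⟫ + μG / 2 * ‖b - a‖ ^ 2)
    (hFlip : LocallyLipschitz F') (hGlip : LocallyLipschitz G')
    (γ : ℝ) (hγ : γ = max (1 / Real.sqrt μF) (1 / Real.sqrt μG))
    (L : EuclideanSpace ℝ (Fin n) → EuclideanSpace ℝ (Fin m) → ℝ)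
    (hL : ∀ p q, L p q = F p + ⟪A p, q⟫ - G q)
    (xstar : EuclideanSpace ℝ (Fin n)) (ystar : EuclideanSpace ℝ (Fin m))
    (hsaddle : ∀ p q, L xstar q ≤ L xstar ystar ∧ L xstar ystar ≤ L p ystar)
    (hfoc1 : F' xstar + (ContinuousLinearMap.adjoint A) ystar = 0)
    (hfoc2 : G' ystar - A xstar = 0)
    (t0 : ℝ) (ht0 : 0 ≤ t0)
    (x x' x'' : ℝ → EuclideanSpace ℝ (Fin n))
    (y y' y'' : ℝ → EuclideanSpace ℝ (Fin m))
    (hx : ∀ t ∈ Set.Ici t0, HasDerivAt x (x' t) t)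
    (hx' : ∀ t ∈ Set.Ici t0, HasDerivAt x' (x'' t) t)
    (hy : ∀ t ∈ Set.Ici t0, HasDerivAt y (y' t) t)
    (hy' : ∀ t ∈ Set.Ici t0, HasDerivAt y' (y'' t) t)
    (hx''c : ContinuousOn x'' (Set.Ici t0)) (hy''c : ContinuousOn y'' (Set.Ici t0))
    (hode1 : ∀ t ∈ Set.Ici t0,
      x'' t + (2 * Real.sqrt μF) • x' t + F' (x t)
        + (ContinuousLinearMap.adjoint A) (y t + γ • y' t) = 0)
    (hode2 : ∀ t ∈ Set.Ici t0,
      y'' t + (2 * Real.sqrt μG) • y' t + G' (y t) - A (x t + γ • x' t) = 0)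
    (u : ℝ → EuclideanSpace ℝ (Fin n)) (v : ℝ → EuclideanSpace ℝ (Fin m))
    (hu : ∀ t, u t = x t - xstar + γ • x' t)
    (hv : ∀ t, v t = y t - ystar + γ • y' t)
    (E : ℝ → ℝ)
    (hE : ∀ t, E t = γ ^ 2 * (L (x t) ystar - L xstar (y t))
      + 1 / 2 * ‖u t‖ ^ 2 + 1 / 2 * ‖v t‖ ^ 2)
    : MeasureTheory.IntegrableOn
        (fun t => Real.exp (t / γ) * (‖x' t‖ ^ 2 + ‖y' t‖ ^ 2)) (Set.Ioi t0) ∧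
      ∫ t in Set.Ioi t0, Real.exp (t / γ) * (‖x' t‖ ^ 2 + ‖y' t‖ ^ 2) ≤
        2 / γ * Real.exp (t0 / γ) * E t0 := by
  have hsF : 0 < Real.sqrt μF := Real.sqrt_pos.2 hμF
  have hsG : 0 < Real.sqrt μG := Real.sqrt_pos.2 hμG
  have hFsq : Real.sqrt μF ^ 2 = μF := Real.sq_sqrt hμF.le
  have hGsq : Real.sqrt μG ^ 2 = μG := Real.sq_sqrt hμG.le
  have hγF : 1 ≤ γ * Real.sqrt μF := by
    rw [← div_le_iff₀ hsF, hγ]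
    exact le_max_left _ _
  have hγG : 1 ≤ γ * Real.sqrt μG := by
    rw [← div_le_iff₀ hsG, hγ]
    exact le_max_right _ _
  have hγ0 : 0 < γ := pos_of_mul_pos_left (one_pos.trans_le hγF) hsF.le
  have hAadj : ∀ p q, ⟪A p, q⟫ = ⟪(ContinuousLinearMap.adjoint A) q, p⟫ := fun p q => by
    rw [ContinuousLinearMap.adjoint_inner_left, real_inner_comm]
  have hE0 : ∀ t, 0 ≤ E t := by
    intro t
    have h1 := (hsaddle (x t) (y t)).1
    have h2 := (hsaddle (x t) (y t)).2
    have h3 : 0 ≤ L (x t) ystar - L xstar (y t) := by linarith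
    rw [hE]
    positivity
  have hED : ∀ t ∈ Set.Ici t0, HasDerivAt E
      (γ ^ 2 * (⟪F' (x t), x' t⟫ + ⟪A (x' t), ystar⟫ + ⟪G' (y t), y' t⟫ - ⟪A xstar, y' t⟫)
        + ⟪u t, x' t + γ • x'' t⟫ + ⟪v t, y' t + γ • y'' t⟫) t := by
    intro t ht
    have dF : HasDerivAt (fun s => F (x s)) ⟪F' (x t), x' t⟫ t := by
      simpa [Function.comp_def] using (hFdiff (x t)).hasFDerivAt.comp_hasDerivAt t (hx t ht)
    have dG : HasDerivAt (fun s => G (y s)) ⟪G' (y t), y' t⟫ t := by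
      simpa [Function.comp_def] using (hGdiff (y t)).hasFDerivAt.comp_hasDerivAt t (hy t ht)
    have dA : HasDerivAt (fun s => ⟪A (x s), ystar⟫) ⟪A (x' t), ystar⟫ t := by
      simpa using (A.hasFDerivAt.comp_hasDerivAt t (hx t ht)).inner ℝ (hasDerivAt_const t ystar)
    have dA' : HasDerivAt (fun s => ⟪A xstar, y s⟫) ⟪A xstar, y' t⟫ t := by
      simpa using (hasDerivAt_const t (A xstar)).inner ℝ (hy t ht)
    have du : HasDerivAt u (x' t + γ • x'' t) t := by
      rw [funext hu]
      exact ((hx t ht).sub_const xstar).add ((hx' t ht).const_smul γ)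
    have dv : HasDerivAt v (y' t + γ • y'' t) t := by
      rw [funext hv]
      exact ((hy t ht).sub_const ystar).add ((hy' t ht).const_smul γ)
    have hEeq : E = fun s => γ ^ 2 * ((F (x s) + ⟪A (x s), ystar⟫ - G ystar)
        - (F xstar + ⟪A xstar, y s⟫ - G (y s))) + 1 / 2 * ‖u s‖ ^ 2 + 1 / 2 * ‖v s‖ ^ 2 := by
      funext s
      rw [hE, hL, hL]
    rw [hEeq]
    refine ((((((dF.add dA).sub_const (G ystar)).sub ((dA'.const_add (F xstar)).sub dG)).const_mul
      (γ ^ 2)).add (du.norm_sq.const_mul (1 / 2))).add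
      (dv.norm_sq.const_mul (1 / 2))).congr_deriv ?_
    ring
  have hdecay : ∀ t ∈ Set.Ici t0,
      γ ^ 2 * (⟪F' (x t), x' t⟫ + ⟪A (x' t), ystar⟫ + ⟪G' (y t), y' t⟫ - ⟪A xstar, y' t⟫)
        + ⟪u t, x' t + γ • x'' t⟫ + ⟪v t, y' t + γ • y'' t⟫ + 1 / γ * E t
        ≤ -(γ / 2 * (‖x' t‖ ^ 2 + ‖y' t‖ ^ 2)) := by
    intro t ht
    have e1 : x' t + γ • x'' t = (1 - 2 * γ * Real.sqrt μF) • x' t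
        - γ • (F' (x t) + (ContinuousLinearMap.adjoint A) ystar)
        - γ • (ContinuousLinearMap.adjoint A) (v t) := by
      have hx2 : x'' t = -((2 * Real.sqrt μF) • x' t + F' (x t)
          + (ContinuousLinearMap.adjoint A) (y t + γ • y' t)) := by
        rw [eq_neg_iff_add_eq_zero, ← hode1 t ht]
        abel
      rw [hx2, hv]
      simp only [map_add, map_sub, map_smul]
      module
    have e2 : y' t + γ • y'' t = (1 - 2 * γ * Real.sqrt μG) • y' t
        - γ • (G' (y t) - A xstar) + γ • A (u t) := by
      have hy2 : y'' t = -((2 * Real.sqrt μG) • y' t + G' (y t) - A (x t + γ • x' t)) := by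
        rw [eq_neg_iff_add_eq_zero, ← hode2 t ht]
        abel
      rw [hy2, hu]
      simp only [map_add, map_sub, map_smul]
      module
    have i1 : ⟪u t, x' t + γ • x'' t⟫ = (1 - 2 * γ * Real.sqrt μF) * ⟪x t - xstar, x' t⟫
        + γ * (1 - 2 * γ * Real.sqrt μF) * ‖x' t‖ ^ 2
        + γ * (⟪F' (x t), xstar - x t⟫ + ⟪A (xstar - x t), ystar⟫)
        - γ ^ 2 * (⟪F' (x t), x' t⟫ + ⟪A (x' t), ystar⟫) - γ * ⟪A (u t), v t⟫ := by
      rw [e1, inner_sub_right, inner_smul_right _ _ γ, ContinuousLinearMap.adjoint_inner_right,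
        inner_sub_right, hu]
      simp only [hAadj, inner_add_left, inner_add_right, inner_sub_left,
        inner_smul_left, inner_smul_right, real_inner_self_eq_norm_sq, RCLike.conj_to_real,
        real_inner_comm _ (F' (x t)), real_inner_comm _ ((ContinuousLinearMap.adjoint A) _)]
      ring
    have i2 : ⟪v t, y' t + γ • y'' t⟫ = (1 - 2 * γ * Real.sqrt μG) * ⟪y t - ystar, y' t⟫
        + γ * (1 - 2 * γ * Real.sqrt μG) * ‖y' t‖ ^ 2
        + γ * (⟪G' (y t), ystar - y t⟫ - ⟪A xstar, ystar - y t⟫)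
        - γ ^ 2 * (⟪G' (y t), y' t⟫ - ⟪A xstar, y' t⟫) + γ * ⟪A (u t), v t⟫ := by
      rw [e2, inner_add_right, inner_smul_right _ _ γ, real_inner_comm (A (u t)) (v t),
        inner_sub_right, hv]
      simp only [inner_add_left, inner_sub_left, inner_sub_right,
        inner_smul_left, inner_smul_right, real_inner_self_eq_norm_sq, RCLike.conj_to_real,
        real_inner_comm _ (G' (y t)), real_inner_comm _ (A _)]
      ring
    have q1 := damped_quadratic_form_le hγ0 hγF (x t - xstar) (x' t)
    have q2 := damped_quadratic_form_le hγ0 hγG (y t - ystar) (y' t)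
    rw [← hu, hFsq] at q1
    rw [← hv, hGsq] at q2
    have c1 := mul_le_mul_of_nonneg_left (hFsc (x t) xstar) hγ0.le
    have c2 := mul_le_mul_of_nonneg_left (hGsc (y t) ystar) hγ0.le
    rw [norm_sub_rev] at c1 c2
    have hEt : 1 / γ * E t = γ * ((F (x t) + ⟪A (x t), ystar⟫ - G ystar)
        - (F xstar + ⟪A xstar, y t⟫ - G (y t))) + 1 / γ * (1 / 2 * ‖u t‖ ^ 2)
        + 1 / γ * (1 / 2 * ‖v t‖ ^ 2) := by
      rw [hE, hL, hL]
      field_simp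
    rw [i1, i2, hEt]
    simp only [map_sub, inner_sub_left (A xstar), inner_sub_right (A xstar)]
    linarith
  have hc : ContinuousOn (fun t => Real.exp (t / γ) * (‖x' t‖ ^ 2 + ‖y' t‖ ^ 2))
      (Set.Ici t0) := by
    have cx : ContinuousOn x' (Set.Ici t0) := fun t ht =>
      (hx' t ht).continuousAt.continuousWithinAt
    have cy : ContinuousOn y' (Set.Ici t0) := fun t ht =>
      (hy' t ht).continuousAt.continuousWithinAt
    fun_prop
  have hmain := integrableOn_Ioi_and_integral_le_of_hasDerivAt_le (half_pos hγ0)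
    (fun t ht => ((hasDerivAt_id t).div_const γ).exp.mul (hED t ht))
    (fun t _ => mul_nonneg (Real.exp_pos _).le (hE0 t)) hc (fun t => by positivity)
    (fun t ht => by
      have := mul_le_mul_of_nonneg_left (hdecay t ht) (Real.exp_pos (t / γ)).le
      simp only [id]
      linarith)
  refine ⟨hmain.1, hmain.2.trans_eq ?_⟩
  simp only [Pi.mul_apply, id]
  field_simp
end
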